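/- Let G be a balanced bipartite graph with parts V1, V2 each of size m+n-1, where m > n ≥ 1 are integers, and suppose the minimum degree of G satisfies δ(G) > (3/4)(m+n-1). Then for every 2-coloring of the edges of G with colors red and blue, there exists a red connected matching of size m (a matching of m edges all lying in one connected component of the red subgraph) or a blue connected matching of size n. -/

import Mathlib

open SimpleGraph Set

/-- A connected `k`-matching in a graph `H`: a matching of `k` edges all of whose
vertices lie in a single connected component of `H`. -/
def ConnMatching {V : Type*} [Fintype V] (H : SimpleGraph V) (k : ℕ) : Prop :=
  ∃ M : H.Subgraph, M.IsMatching ∧ M.edgeSet.ncard = k ∧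
    ∃ c : H.ConnectedComponent, ∀ v ∈ M.verts, H.connectedComponentMk v = c

/-- **König's theorem**, in the form of a dichotomy: a relation between finite types either
contains a matching of size `k` or is covered by fewer than `k` points. -/
theorem exists_matching_or_exists_cover {α β : Type*} [Fintype α] [Fintype β]
    (E : α → β → Prop) (k : ℕ) :
    (∃ (M : Finset α) (g : M → β), M.card = k ∧ Function.Injective g ∧ ∀ x : M, E x (g x)) ∨
    (∃ (S : Finset α) (T : Finset β), S.card + T.card < k ∧ ∀ x y, E x y → x ∈ S ∨ y ∈ T) := by
  classical
  by_contra! h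
  obtain ⟨hM, hC⟩ := h
  have hcov : ∀ (S : Finset α) (T : Finset β), (∀ x y, E x y → x ∈ S ∨ y ∈ T) →
      k ≤ S.card + T.card := by
    intro S T hST
    by_contra! hlt
    obtain ⟨x, y, hE, hx, hy⟩ := hC S T hlt
    rcases hST x y hE with h | h
    · exact hx h
    · exact hy h
  have hk : k ≤ Fintype.card α := by
    simpa using hcov Finset.univ ∅ (fun x y _ => Or.inl (Finset.mem_univ x))
  set d := Fintype.card α - k with hd
  let nbr : α → Finset β := fun x => Finset.univ.filter (E x)
  let t : α → Finset (β ⊕ Fin d) := fun x => (nbr x).disjSum Finset.univ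
  have hall : ∀ X : Finset α, X.card ≤ (X.biUnion t).card := by
    intro X
    rcases X.eq_empty_or_nonempty with rfl | ⟨x₀, hx₀⟩
    · simp
    have h1 := hcov Xᶜ (X.biUnion nbr) (by
      intro x y hE
      by_cases hx : x ∈ X
      · right
        simp only [Finset.mem_biUnion]
        exact ⟨x, hx, by simp [nbr, hE]⟩
      · left
        simpa using hx)
    have h2 : (X.biUnion nbr).disjSum (Finset.univ : Finset (Fin d)) ⊆ X.biUnion t := by
      intro z hz
      rcases z with y | e
      · simp only [Finset.inl_mem_disjSum, Finset.mem_biUnion] at hz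
        obtain ⟨x, hx, hy⟩ := hz
        simp only [Finset.mem_biUnion]
        exact ⟨x, hx, by simpa [t] using hy⟩
      · simp only [Finset.mem_biUnion]
        exact ⟨x₀, hx₀, by simp [t]⟩
    have h3 := Finset.card_le_card h2
    rw [Finset.card_disjSum, Finset.card_univ, Fintype.card_fin] at h3
    rw [Finset.card_compl] at h1
    have h4 := Finset.card_le_univ X
    omega
  obtain ⟨f, hf, hft⟩ := (Finset.all_card_le_biUnion_card_iff_exists_injective t).1 hall
  let L : Finset α := Finset.univ.filter fun x => ∃ y, f x = Sum.inl y
  have hL : k ≤ L.card := by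
    have h1 : Lᶜ.card ≤ d := by
      have : (Lᶜ.image f) ⊆ (∅ : Finset β).disjSum (Finset.univ : Finset (Fin d)) := by
        intro z hz
        obtain ⟨x, hx, rfl⟩ := Finset.mem_image.1 hz
        rcases hfx : f x with y | e
        · simp [L, hfx] at hx
        · simp
      have h2 := Finset.card_le_card this
      rw [Finset.card_image_of_injective _ hf, Finset.card_disjSum] at h2
      simpa using h2
    rw [Finset.card_compl] at h1
    omega
  obtain ⟨M, hML, hMk⟩ := Finset.exists_subset_card_eq hL
  have hex : ∀ x : M, ∃ y, f x = Sum.inl y := fun x => by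
    simpa [L] using hML x.2
  choose g hg using hex
  obtain ⟨x, hx⟩ := hM M g hMk (by
    intro x y hxy
    apply Subtype.ext
    apply hf
    rw [hg, hg, hxy])
  apply hx
  have := hft x
  rw [hg] at this
  simpa [t, nbr] using this

/-- If no component of a bipartite graph contains a matching of size `k`, then the edges of every
component are covered by fewer than `k` vertices. -/
theorem exists_cover_of_not_connMatching {V : Type*} [Fintype V] {H : SimpleGraph V} {k : ℕ}
    {V1 V2 : Finset V} (hdisj : Disjoint V1 V2) (h : ¬ ConnMatching H k)
    (c : H.ConnectedComponent) :
    ∃ (S : Finset V1) (T : Finset V2), S.card + T.card < k ∧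
      ∀ x y, H.Adj x.1 y.1 → H.connectedComponentMk x.1 = c → x ∈ S ∨ y ∈ T := by
  classical
  rcases exists_matching_or_exists_cover
    (fun (x : V1) (y : V2) => H.Adj x.1 y.1 ∧ H.connectedComponentMk x.1 = c) k with
    ⟨M, g, hMk, hg, hE⟩ | ⟨S, T, hlt, hST⟩
  · exfalso
    apply h
    have hne : ∀ (a : V1) (b : V2), a.1 ≠ b.1 := fun a b hab =>
      Finset.disjoint_left.1 hdisj a.2 (hab ▸ b.2)
    let K : H.Subgraph :=
      { verts := {v | ∃ x : M, v = x.1.1 ∨ v = (g x).1}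
        Adj := fun v w => ∃ x : M, (v = x.1.1 ∧ w = (g x).1) ∨ (w = x.1.1 ∧ v = (g x).1)
        adj_sub := by
          rintro v w ⟨x, ⟨rfl, rfl⟩ | ⟨rfl, rfl⟩⟩
          · exact (hE x).1
          · exact (hE x).1.symm
        edge_vert := by
          rintro v w ⟨x, ⟨rfl, rfl⟩ | ⟨rfl, rfl⟩⟩
          · exact ⟨x, Or.inl rfl⟩
          · exact ⟨x, Or.inr rfl⟩
        symm := ⟨by
          rintro v w ⟨x, hx⟩
          exact ⟨x, hx.symm⟩⟩ }
    refine ⟨K, ?_, ?_, c, ?_⟩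
    · rintro v ⟨x, rfl | rfl⟩
      · refine ⟨(g x).1, ⟨x, Or.inl ⟨rfl, rfl⟩⟩, ?_⟩
        rintro w ⟨z, ⟨h1, rfl⟩ | ⟨_, h1⟩⟩
        · rw [Subtype.ext (Subtype.ext h1) (a1 := x) (a2 := z)]
        · exact absurd h1 (hne _ _)
      · refine ⟨x.1.1, ⟨x, Or.inr ⟨rfl, rfl⟩⟩, ?_⟩
        rintro w ⟨z, ⟨h1, _⟩ | ⟨rfl, h1⟩⟩
        · exact absurd h1.symm (hne _ _)
        · rw [hg (Subtype.ext h1)]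
    · have hset : K.edgeSet = Set.range fun x : M => s(x.1.1, (g x).1) := by
        ext e
        induction e with
        | _ v w =>
          simp only [Subgraph.mem_edgeSet, Set.mem_range, Sym2.eq_iff]
          constructor
          · rintro ⟨x, ⟨rfl, rfl⟩ | ⟨rfl, rfl⟩⟩
            · exact ⟨x, Or.inl ⟨rfl, rfl⟩⟩
            · exact ⟨x, Or.inr ⟨rfl, rfl⟩⟩
          · rintro ⟨x, ⟨rfl, rfl⟩ | ⟨rfl, rfl⟩⟩
            · exact ⟨x, Or.inl ⟨rfl, rfl⟩⟩
            · exact ⟨x, Or.inr ⟨rfl, rfl⟩⟩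
      rw [hset, ← Set.image_univ, Set.ncard_image_of_injective, Set.ncard_univ,
        Nat.card_eq_fintype_card, Fintype.card_coe, hMk]
      intro x z hxz
      rcases Sym2.eq_iff.1 hxz with ⟨h1, _⟩ | ⟨h1, _⟩
      · exact Subtype.ext (Subtype.ext h1)
      · exact absurd h1 (hne _ _)
    · rintro v ⟨x, rfl | rfl⟩
      · exact (hE x).2
      · rw [← (hE x).2]
        exact (ConnectedComponent.connectedComponentMk_eq_of_adj (hE x).1).symm
  · exact ⟨S, T, hlt, fun x y hxy hx => hST x y ⟨hxy, hx⟩⟩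

/-- A relation between two sets of `N` points in which every point has fewer than `N / 4`
non-neighbours, written as the union of `red` and `blue`. The points are labelled by their red and
blue components, each red component is covered by fewer than `p` points and each blue one by fewer
than `q` points, where `p + q = N + 1`. -/
structure CoveredColoring (α β I J : Type*) [Fintype α] [Fintype β] (N p q : ℕ) where
  red : α → β → Prop
  blue : α → β → Prop
  rL : α → I
  rR : β → I
  bL : α → J
  bR : β → J
  card_left : Fintype.card α = N
  card_right : Fintype.card β = N
  add_eq : p + q = N + 1
  left_few : ∀ (x : α) (D : Finset β), (∀ y ∈ D, ¬ red x y ∧ ¬ blue x y) → 4 * D.card < N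
  right_few : ∀ (y : β) (D : Finset α), (∀ x ∈ D, ¬ red x y ∧ ¬ blue x y) → 4 * D.card < N
  red_eq : ∀ x y, red x y → rL x = rR y
  blue_eq : ∀ x y, blue x y → bL x = bR y
  red_cover : ∀ i, ∃ (S : Finset α) (T : Finset β), S.card + T.card < p ∧
    ∀ x y, red x y → rL x = i → x ∈ S ∨ y ∈ T
  blue_cover : ∀ j, ∃ (S : Finset α) (T : Finset β), S.card + T.card < q ∧
    ∀ x y, blue x y → bL x = j → x ∈ S ∨ y ∈ T

namespace CoveredColoring

variable {α β I J : Type*} [Fintype α] [Fintype β] {N p q : ℕ}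

/-- Exchange the two sides. -/
def swap (c : CoveredColoring α β I J N p q) : CoveredColoring β α I J N p q where
  red y x := c.red x y
  blue y x := c.blue x y
  rL := c.rR
  rR := c.rL
  bL := c.bR
  bR := c.bL
  card_left := c.card_right
  card_right := c.card_left
  add_eq := c.add_eq
  left_few := c.right_few
  right_few := c.left_few
  red_eq y x h := (c.red_eq x y h).symm
  blue_eq y x h := (c.blue_eq x y h).symm
  red_cover i := by
    obtain ⟨S, T, h, hc⟩ := c.red_cover i
    exact ⟨T, S, by omega, fun y x hr hy => (hc x y hr ((c.red_eq x y hr).trans hy)).symm⟩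
  blue_cover j := by
    obtain ⟨S, T, h, hc⟩ := c.blue_cover j
    exact ⟨T, S, by omega, fun y x hr hy => (hc x y hr ((c.blue_eq x y hr).trans hy)).symm⟩

/-- Exchange the two colors. -/
def recolor (c : CoveredColoring α β I J N p q) : CoveredColoring α β J I N q p where
  red := c.blue
  blue := c.red
  rL := c.bL
  rR := c.bR
  bL := c.rL
  bR := c.rR
  card_left := c.card_left
  card_right := c.card_right
  add_eq := by have := c.add_eq; omega
  left_few x D h := c.left_few x D fun y hy => (h y hy).symm
  right_few y D h := c.right_few y D fun x hx => (h x hx).symm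
  red_eq := c.blue_eq
  blue_eq := c.red_eq
  red_cover := c.blue_cover
  blue_cover := c.red_cover

theorem exists_notMem {γ : Type*} [Fintype γ] {S : Finset γ} (h : S.card < Fintype.card γ) :
    ∃ x, x ∉ S := by
  by_contra! hS
  rw [Finset.eq_univ_of_forall hS, Finset.card_univ] at h
  exact lt_irrefl _ h

/-- A large set of left points all of whose edges are covered lies in the cover. -/
theorem subset_of_cover (c : CoveredColoring α β I J N p q) {X S : Finset α} {T : Finset β}
    (hlt : S.card + T.card < N) (hX : N ≤ 2 * X.card)
    (hc : ∀ x ∈ X, ∀ y, c.red x y ∨ c.blue x y → x ∈ S ∨ y ∈ T) : X ⊆ S := by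
  classical
  intro x hx
  by_contra hxS
  obtain ⟨y, hy⟩ := exists_notMem (S := T) (by rw [c.card_right]; omega)
  have h1 := c.left_few x Tᶜ (by
    intro y hy
    have := hc x hx y
    simp only [Finset.mem_compl] at hy
    tauto)
  have h2 := c.right_few y (X \ S) (by
    intro x hx
    have := hc x (Finset.mem_sdiff.1 hx).1 y
    have := (Finset.mem_sdiff.1 hx).2
    tauto)
  rw [Finset.card_compl, c.card_right] at h1
  have h3 := Finset.card_le_card_sdiff_add_card (s := X) (t := S)
  omega

/-- The edges cannot all be covered by fewer than `N` points. -/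
theorem exists_uncovered (c : CoveredColoring α β I J N p q) {S : Finset α} {T : Finset β}
    (hlt : S.card + T.card < N) : ∃ x ∉ S, ∃ y ∉ T, c.red x y ∨ c.blue x y := by
  by_contra! h
  have hS := c.subset_of_cover (X := Finset.univ) hlt
    (by rw [Finset.card_univ, c.card_left]; omega) (by
      intro x _ y hxy
      have := h x
      by_contra! hn
      have := h x hn.1 y hn.2
      tauto)
  have := Finset.card_le_card hS
  rw [Finset.card_univ, c.card_left] at this
  omega

/-- The red edges cannot be covered by fewer than `p` points, at most half of a side on the right. -/
theorem not_covered_of_right_small (c : CoveredColoring α β I J N p q) {S : Finset α}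
    {T : Finset β} (hS : S.card + T.card < p) (hT : 2 * T.card ≤ N)
    (hc : ∀ x y, c.red x y → x ∈ S ∨ y ∈ T) (hq : 0 < q) : False := by
  classical
  have hpq := c.add_eq
  obtain ⟨x₀, hx₀⟩ := exists_notMem (S := S) (by rw [c.card_left]; omega)
  have hblue : ∀ x ∉ S, c.bL x = c.bL x₀ := by
    intro x hx
    by_contra hne
    let D (z : α) : Finset β := Finset.univ.filter fun y => y ∉ T ∧ ¬ c.blue z y
    have hD : ∀ z ∉ S, 4 * (D z).card < N := by
      intro z hz
      apply c.left_few z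
      intro y hy
      simp only [D, Finset.mem_filter, Finset.mem_univ, true_and] at hy
      have := hc z y
      tauto
    have hcov : (Finset.univ : Finset β) ⊆ T ∪ (D x ∪ D x₀) := by
      intro y _
      have h1 := c.blue_eq x y
      have h2 := c.blue_eq x₀ y
      simp only [D, Finset.mem_union, Finset.mem_filter, Finset.mem_univ, true_and]
      by_contra! hn
      apply hne
      rw [h1 (hn.2.1 hn.1), h2 (hn.2.2 hn.1)]
    have h1 := Finset.card_le_card hcov
    rw [Finset.card_univ, c.card_right] at h1
    have h2 := Finset.card_union_le T (D x ∪ D x₀)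
    have h3 := Finset.card_union_le (D x) (D x₀)
    have h4 := hD x hx
    have h5 := hD x₀ hx₀
    omega
  obtain ⟨S', T', hlt, hc'⟩ := c.blue_cover (c.bL x₀)
  have h1 := Finset.card_union_le S S'
  have h2 := Finset.card_union_le T T'
  obtain ⟨x, hx, y, hy, hxy⟩ := c.exists_uncovered (S := S ∪ S') (T := T ∪ T') (by omega)
  simp only [Finset.mem_union, not_or] at hx hy
  rcases hxy with h | h
  · have := hc x y h
    tauto
  · have := hc' x y h (hblue x hx.1)
    tauto

/-- The red edges do not all lie in one component. -/
theorem not_red_connected (c : CoveredColoring α β I J N p q) (i : I)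
    (h : ∀ x y, c.red x y → c.rL x = i) (hq : 0 < q) : False := by
  obtain ⟨S, T, hlt, hc⟩ := c.red_cover i
  have hc' : ∀ x y, c.red x y → x ∈ S ∨ y ∈ T := fun x y hr => hc x y hr (h x y hr)
  have := c.add_eq
  by_cases hT : 2 * T.card ≤ N
  · exact c.not_covered_of_right_small hlt hT hc' hq
  · exact c.swap.not_covered_of_right_small (S := T) (T := S) (by omega) (by omega)
      (fun y x hr => (hc' x y hr).symm) hq

/-- Two left points in different components of both colors force a large cell on the right. -/
theorem exists_large_cell (c : CoveredColoring α β I J N p q) {x x' : α}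
    (hr : c.rL x ≠ c.rL x') (hb : c.bL x ≠ c.bL x') :
    ∃ (i : I) (j : J) (Y : Finset β), N < 4 * Y.card ∧ ∀ y, y ∈ Y ↔ c.rR y = i ∧ c.bR y = j := by
  classical
  let Y (z z' : α) : Finset β := Finset.univ.filter fun y => c.rR y = c.rL z ∧ c.bR y = c.bL z'
  let D (z : α) : Finset β := Finset.univ.filter fun y => ¬ c.red z y ∧ ¬ c.blue z y
  have hD : ∀ z, 4 * (D z).card < N := fun z => c.left_few z _ (by simp [D])
  have hcov : (Finset.univ : Finset β) ⊆ (Y x x' ∪ Y x' x) ∪ (D x ∪ D x') := by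
    intro y _
    have h1 := c.blue_eq x y
    have h2 := c.blue_eq x' y
    have h3 := c.red_eq x y
    have h4 := c.red_eq x' y
    simp only [Y, D, Finset.mem_union, Finset.mem_filter, Finset.mem_univ, true_and]
    by_cases hx : c.red x y <;> by_cases hx' : c.red x' y <;> grind
  have h1 := Finset.card_le_card hcov
  rw [Finset.card_univ, c.card_right] at h1
  have h2 := Finset.card_union_le (Y x x' ∪ Y x' x) (D x ∪ D x')
  have h3 := Finset.card_union_le (D x) (D x')
  have h4 := Finset.card_union_le (Y x x') (Y x' x)
  have h5 := hD x
  have h6 := hD x'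
  by_cases h : N < 4 * (Y x x').card
  · exact ⟨c.rL x, c.bL x', Y x x', h, by simp [Y]⟩
  · exact ⟨c.rL x', c.bL x, Y x' x, by omega, by simp [Y]⟩

/-- Every left point shares a component with a large cell on the right. -/
theorem eq_or_eq_of_large (c : CoveredColoring α β I J N p q) {i : I} {j : J} {Y : Finset β}
    (hY : N ≤ 4 * Y.card) (hij : ∀ y ∈ Y, c.rR y = i ∧ c.bR y = j) (x : α) :
    c.rL x = i ∨ c.bL x = j := by
  by_contra! h
  have := c.left_few x Y (by
    intro y hy
    have h1 := c.blue_eq x y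
    have h2 := c.red_eq x y
    have := hij y hy
    grind)
  omega

/-- The left points do not pairwise share a component. -/
theorem exists_separated (c : CoveredColoring α β I J N p q) (hp : 0 < p) (hq : 0 < q) :
    ∃ x x', c.rL x ≠ c.rL x' ∧ c.bL x ≠ c.bL x' := by
  by_contra! h
  have hpq := c.add_eq
  obtain ⟨x₀, -⟩ := exists_notMem (S := (∅ : Finset α)) (by rw [c.card_left]; simp; omega)
  have h1 : ∃ x, c.rL x ≠ c.rL x₀ := by
    by_contra! hn
    exact c.not_red_connected _ (fun x _ _ => hn x) hq
  have h2 : ∃ x, c.bL x ≠ c.bL x₀ := by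
    by_contra! hn
    exact c.recolor.not_red_connected _ (fun x _ _ => hn x) hp
  obtain ⟨x, hx⟩ := h1
  obtain ⟨z, hz⟩ := h2
  have := h x x₀
  have := h z x₀
  have := h x z
  grind

/-- If all points share a component with the pair `(i, j)` but the left points are neither all in
`i` nor all in `j`, then more than half of the right points lie in the cell `(i, j)`. -/
theorem exists_half_cell (c : CoveredColoring α β I J N p q) {i : I} {j : J}
    (hα : ∀ x, c.rL x = i ∨ c.bL x = j) (hβ : ∀ y, c.rR y = i ∨ c.bR y = j) {x₁ x₂ : α}
    (hx₁ : c.rL x₁ ≠ i) (hx₂ : c.bL x₂ ≠ j) :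
    ∃ Y : Finset β, N < 2 * Y.card ∧ ∀ y ∈ Y, c.rR y = i ∧ c.bR y = j := by
  classical
  let Y : Finset β := Finset.univ.filter fun y => c.rR y = i ∧ c.bR y = j
  let D₁ : Finset β := Finset.univ.filter fun y => c.bR y ≠ j
  let D₂ : Finset β := Finset.univ.filter fun y => c.rR y ≠ i
  have h1 := c.left_few x₁ D₁ (by
    intro y hy
    simp only [D₁, Finset.mem_filter, Finset.mem_univ, true_and] at hy
    have := c.red_eq x₁ y
    have := c.blue_eq x₁ y
    have := hα x₁
    have := hβ y
    grind)
  have h2 := c.left_few x₂ D₂ (by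
    intro y hy
    simp only [D₂, Finset.mem_filter, Finset.mem_univ, true_and] at hy
    have := c.red_eq x₂ y
    have := c.blue_eq x₂ y
    have := hα x₂
    have := hβ y
    grind)
  have hcov : (Finset.univ : Finset β) ⊆ Y ∪ (D₁ ∪ D₂) := by
    intro y _
    simp only [Y, D₁, D₂, Finset.mem_union, Finset.mem_filter, Finset.mem_univ, true_and]
    tauto
  have h3 := Finset.card_le_card hcov
  rw [Finset.card_univ, c.card_right] at h3
  have h4 := Finset.card_union_le Y (D₁ ∪ D₂)
  have h5 := Finset.card_union_le D₁ D₂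
  exact ⟨Y, by omega, by simp [Y]⟩

/-- The points do not all share a component with one fixed pair of components. -/
theorem not_same_cross (c : CoveredColoring α β I J N p q) (hp : 0 < p) (hq : 0 < q) {i : I} {j : J}
    (hα : ∀ x, c.rL x = i ∨ c.bL x = j) (hβ : ∀ y, c.rR y = i ∨ c.bR y = j) : False := by
  classical
  have hpq := c.add_eq
  obtain ⟨x₁, hx₁⟩ : ∃ x, c.rL x ≠ i := by
    by_contra! hn
    exact c.not_red_connected _ (fun x _ _ => hn x) hq
  obtain ⟨x₂, hx₂⟩ : ∃ x, c.bL x ≠ j := by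
    by_contra! hn
    exact c.recolor.not_red_connected _ (fun x _ _ => hn x) hp
  obtain ⟨y₁, hy₁⟩ : ∃ y, c.rR y ≠ i := by
    by_contra! hn
    exact c.swap.not_red_connected _ (fun x _ _ => hn x) hq
  obtain ⟨y₂, hy₂⟩ : ∃ y, c.bR y ≠ j := by
    by_contra! hn
    exact c.swap.recolor.not_red_connected _ (fun x _ _ => hn x) hp
  obtain ⟨Y, hY, hYij⟩ := c.exists_half_cell hα hβ hx₁ hx₂
  obtain ⟨X, hX, hXij⟩ := c.swap.exists_half_cell hβ hα hy₁ hy₂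
  obtain ⟨S, T, hlt, hc⟩ := c.red_cover i
  obtain ⟨S', T', hlt', hc'⟩ := c.blue_cover j
  have h1 := Finset.card_union_le S S'
  have h2 := Finset.card_union_le T T'
  have h3 := Finset.card_le_card (c.subset_of_cover (X := X) (S := S ∪ S') (T := T ∪ T')
    (by omega) (by omega) (by
      intro x hx y hxy
      have hx := hXij x hx
      have := hc x y
      have := hc' x y
      simp only [Finset.mem_union]
      change c.rL x = i ∧ c.bL x = j at hx
      tauto))
  have h4 := Finset.card_le_card (c.swap.subset_of_cover (X := Y) (S := T ∪ T') (T := S ∪ S')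
    (by omega) (by omega) (by
      intro y hy x hxy
      have hy := hYij y hy
      change c.red x y ∨ c.blue x y at hxy
      have := hc x y
      have := hc' x y
      have := c.red_eq x y
      have := c.blue_eq x y
      simp only [Finset.mem_union]
      grind))
  omega

/-- Two large sets are not covered by few points. -/
theorem not_cover_of_large (c : CoveredColoring α β I J N p q) {X S : Finset α} {Y T : Finset β}
    {k : ℕ} (hlt : S.card + T.card < k) (hX : k ≤ X.card) (hY : k ≤ Y.card)
    (hXY : N + 2 * k ≤ 2 * (X.card + Y.card) + 2)
    (hc : ∀ x ∈ X, ∀ y ∈ Y, c.red x y ∨ c.blue x y → x ∈ S ∨ y ∈ T) : False := by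
  classical
  obtain ⟨x, hx, hxS⟩ := Finset.exists_mem_notMem_of_card_lt_card (s := S) (t := X) (by omega)
  obtain ⟨y, hy, hyT⟩ := Finset.exists_mem_notMem_of_card_lt_card (s := T) (t := Y) (by omega)
  have h1 := c.left_few x (Y \ T) (by
    intro z hz
    rw [Finset.mem_sdiff] at hz
    have := hc x hx z hz.1
    tauto)
  have h2 := c.right_few y (X \ S) (by
    intro z hz
    rw [Finset.mem_sdiff] at hz
    have := hc z hz.1 y hy
    tauto)
  have h3 := Finset.card_le_card_sdiff_add_card (s := X) (t := S)
  have h4 := Finset.card_le_card_sdiff_add_card (s := Y) (t := T)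
  omega

theorem not_four_cells_of_le (c : CoveredColoring α β I J N p q) (hqp : q ≤ p) {i₁ i₂ : I}
    {j₁ j₂ : J} (hi : i₁ ≠ i₂) (hj : j₁ ≠ j₂)
    (hα : ∀ x, (c.rL x = i₁ ∧ c.bL x = j₂) ∨ (c.rL x = i₂ ∧ c.bL x = j₁))
    (hβ : ∀ y, (c.rR y = i₁ ∧ c.bR y = j₁) ∨ (c.rR y = i₂ ∧ c.bR y = j₂)) : False := by
  classical
  have hpq := c.add_eq
  let X₁ : Finset α := Finset.univ.filter fun x => c.rL x = i₁
  let X₂ : Finset α := Finset.univ.filter fun x => ¬ c.rL x = i₁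
  let Y₁ : Finset β := Finset.univ.filter fun y => c.rR y = i₁
  let Y₂ : Finset β := Finset.univ.filter fun y => ¬ c.rR y = i₁
  have hX : X₁.card + X₂.card = N := by
    rw [← c.card_left, ← Finset.card_univ]
    exact Finset.card_filter_add_card_filter_not _
  have hY : Y₁.card + Y₂.card = N := by
    rw [← c.card_right, ← Finset.card_univ]
    exact Finset.card_filter_add_card_filter_not _
  obtain ⟨S₁, T₁, hl₁, hc₁⟩ := c.red_cover i₁
  obtain ⟨S₂, T₂, hl₂, hc₂⟩ := c.red_cover i₂
  obtain ⟨S₃, T₃, hl₃, hc₃⟩ := c.blue_cover j₁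
  obtain ⟨S₄, T₄, hl₄, hc₄⟩ := c.blue_cover j₂
  have h1 : ¬ (p ≤ X₁.card ∧ p ≤ Y₁.card) := fun h =>
    c.not_cover_of_large hl₁ h.1 h.2 (by omega) (by
      intro x hx y hy
      simp only [X₁, Y₁, Finset.mem_filter, Finset.mem_univ, true_and] at hx hy
      have := hc₁ x y
      have := c.blue_eq x y
      have := hα x
      have := hβ y
      grind)
  have h2 : ¬ (p ≤ X₂.card ∧ p ≤ Y₂.card) := fun h =>
    c.not_cover_of_large hl₂ h.1 h.2 (by omega) (by
      intro x hx y hy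
      simp only [X₂, Y₂, Finset.mem_filter, Finset.mem_univ, true_and] at hx hy
      have := hc₂ x y
      have := c.blue_eq x y
      have := hα x
      have := hβ y
      grind)
  have h3 : ¬ (q ≤ X₂.card ∧ q ≤ Y₁.card ∧ N ≤ X₂.card + Y₁.card) := fun h =>
    c.not_cover_of_large hl₃ h.1 h.2.1 (by omega) (by
      intro x hx y hy
      simp only [X₂, Y₁, Finset.mem_filter, Finset.mem_univ, true_and] at hx hy
      have := hc₃ x y
      have := c.red_eq x y
      have := hα x
      have := hβ y
      grind)
  have h4 : ¬ (q ≤ X₁.card ∧ q ≤ Y₂.card ∧ N ≤ X₁.card + Y₂.card) := fun h =>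
    c.not_cover_of_large hl₄ h.1 h.2.1 (by omega) (by
      intro x hx y hy
      simp only [X₁, Y₂, Finset.mem_filter, Finset.mem_univ, true_and] at hx hy
      have := hc₄ x y
      have := c.red_eq x y
      have := hα x
      have := hβ y
      grind)
  omega

/-- The points do not lie in two disjoint cells on either side, the four cells forming a
`2 × 2` square. -/
theorem not_four_cells (c : CoveredColoring α β I J N p q) {i₁ i₂ : I}
    {j₁ j₂ : J} (hi : i₁ ≠ i₂) (hj : j₁ ≠ j₂)
    (hα : ∀ x, (c.rL x = i₁ ∧ c.bL x = j₂) ∨ (c.rL x = i₂ ∧ c.bL x = j₁))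
    (hβ : ∀ y, (c.rR y = i₁ ∧ c.bR y = j₁) ∨ (c.rR y = i₂ ∧ c.bR y = j₂)) : False := by
  rcases le_total q p with h | h
  · exact c.not_four_cells_of_le h hi hj hα hβ
  · exact c.recolor.not_four_cells_of_le h hj.symm hi.symm (fun x => (hα x).imp And.symm And.symm)
      (fun y => (hβ y).symm.imp And.symm And.symm)

/-- A large cell on the left is not covered by the left half of a red cover if many right points
share only its blue component. -/
theorem exists_notMem_red_cover (c : CoveredColoring α β I J N p q) {i : I} {j : J} {X : Finset α}
    {Y : Finset β} (hX : 3 * N ≤ 4 * X.card) (hXij : ∀ x ∈ X, c.rL x = i ∧ c.bL x = j)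
    (hY : N ≤ 4 * Y.card) (hYij : ∀ y ∈ Y, c.rR y ≠ i ∧ c.bR y = j) {S : Finset α} {T : Finset β}
    (hlt : S.card + T.card < p) : ∃ x ∈ X, x ∉ S := by
  classical
  by_contra! hXS
  have hpq := c.add_eq
  have h1 := Finset.card_le_card hXS
  obtain ⟨S', T', hlt', hc'⟩ := c.blue_cover j
  obtain ⟨y, hy, hyT⟩ := Finset.exists_mem_notMem_of_card_lt_card (s := T') (t := Y) (by omega)
  have h2 := c.right_few y (X \ S') (by
    intro x hx
    rw [Finset.mem_sdiff] at hx
    have := hXij x hx.1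
    have := hYij y hy
    have := hc' x y
    have := c.red_eq x y
    grind)
  have h3 := Finset.card_le_card_sdiff_add_card (s := X) (t := S')
  omega

/-- There is no cell containing three quarters of the left side if the right side has many points
in the red and in the blue component of this cell, but few in both. -/
theorem not_dominating_cell (c : CoveredColoring α β I J N p q) {i : I} {j : J} {X : Finset α}
    {Y₁ Y₂ Y₃ : Finset β} (hX : 3 * N ≤ 4 * X.card) (hXij : ∀ x ∈ X, c.rL x = i ∧ c.bL x = j)
    (hY₁ : N ≤ 4 * Y₁.card) (hY₂ : N ≤ 4 * Y₂.card) (hY₃ : 4 * Y₃.card < N)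
    (hYij₁ : ∀ y ∈ Y₁, c.rR y = i ∧ c.bR y ≠ j) (hYij₂ : ∀ y ∈ Y₂, c.rR y ≠ i ∧ c.bR y = j)
    (hY : ∀ y, y ∈ Y₁ ∨ y ∈ Y₂ ∨ y ∈ Y₃) : False := by
  classical
  have hpq := c.add_eq
  obtain ⟨S, T, hlt, hc⟩ := c.red_cover i
  obtain ⟨S', T', hlt', hc'⟩ := c.blue_cover j
  obtain ⟨u, hu, huS⟩ := c.exists_notMem_red_cover hX hXij hY₂ hYij₂ hlt
  obtain ⟨u', hu', huS'⟩ := c.recolor.exists_notMem_red_cover hX (fun x hx => (hXij x hx).symm)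
    hY₁ (fun y hy => (hYij₁ y hy).symm) hlt'
  have h1 := Finset.card_union_le S S'
  have h2 := Finset.card_le_card (c.subset_of_cover (X := X) (S := S ∪ S') (T := T ∪ T')
    (by have := Finset.card_union_le T T'; omega) (by omega) (by
      intro x hx y hxy
      have hx := hXij x hx
      have := hc x y
      have := hc' x y
      simp only [Finset.mem_union]
      tauto))
  have h3 := c.left_few u (Y₁ \ T) (by
    intro y hy
    rw [Finset.mem_sdiff] at hy
    have := hXij u hu
    have := hYij₁ y hy.1
    have := hc u y
    have := c.blue_eq u y
    grind)
  have h4 := c.left_few u' (Y₂ \ T') (by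
    intro y hy
    rw [Finset.mem_sdiff] at hy
    have := hXij u' hu'
    have := hYij₂ y hy.1
    have := hc' u' y
    have := c.red_eq u' y
    grind)
  have h5 := Finset.card_le_card_sdiff_add_card (s := Y₁) (t := T)
  have h6 := Finset.card_le_card_sdiff_add_card (s := Y₂) (t := T')
  have hcov : (Finset.univ : Finset β) ⊆ Y₁ ∪ (Y₂ ∪ Y₃) := by
    intro y _
    simpa using hY y
  have h7 := Finset.card_le_card hcov
  rw [Finset.card_univ, c.card_right] at h7
  have h8 := Finset.card_union_le Y₁ (Y₂ ∪ Y₃)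
  have h9 := Finset.card_union_le Y₂ Y₃
  omega

/-- A cover of the red component `i` missing points inside and outside of the blue component `j₂`
contains more than half of the right side. -/
theorem half_lt_red_cover (c : CoveredColoring α β I J N p q) {i : I} {j₂ : J}
    {S : Finset α} {T : Finset β}
    (hc : ∀ x y, c.red x y → c.rL x = i → x ∈ S ∨ y ∈ T) {u v : α}
    (hu : c.rL u = i ∧ c.bL u = j₂ ∧ u ∉ S) (hv : c.rL v = i ∧ c.bL v ≠ j₂ ∧ v ∉ S) :
    N < 2 * T.card := by
  classical
  let D : Finset β := Finset.univ.filter fun y => c.bR y ≠ j₂ ∧ y ∉ T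
  let D' : Finset β := Finset.univ.filter fun y => c.bR y = j₂ ∧ y ∉ T
  have h1 := c.left_few u D (by
    intro y hy
    simp only [D, Finset.mem_filter, Finset.mem_univ, true_and] at hy
    have := hc u y
    have := c.blue_eq u y
    grind)
  have h2 := c.left_few v D' (by
    intro y hy
    simp only [D', Finset.mem_filter, Finset.mem_univ, true_and] at hy
    have := hc v y
    have := c.blue_eq v y
    grind)
  have hcov : (Finset.univ : Finset β) ⊆ T ∪ (D ∪ D') := by
    intro y _
    simp only [D, D', Finset.mem_union, Finset.mem_filter, Finset.mem_univ, true_and]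
    tauto
  have h3 := Finset.card_le_card hcov
  rw [Finset.card_univ, c.card_right] at h3
  have h4 := Finset.card_union_le T (D ∪ D')
  have h5 := Finset.card_union_le D D'
  omega

/-- Fewer than `q` left points lie outside of the red component `i`. -/
theorem card_off_row_lt (c : CoveredColoring α β I J N p q) {i : I} {j : J}
    (hα : ∀ x, c.rL x = i ∨ c.bL x = j) {X A : Finset α} {Y : Finset β} (hX : N ≤ 2 * X.card)
    (hY : N ≤ 2 * Y.card) (hXi : ∀ x ∈ X, c.rL x = i) (hYij : ∀ y ∈ Y, c.rR y = i ∧ c.bR y = j)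
    (hA : ∀ x ∈ A, c.rL x ≠ i) : A.card < q := by
  classical
  have hXA : X.card + A.card ≤ N := by
    rw [← c.card_left, ← Finset.card_union_of_disjoint]
    · exact Finset.card_le_univ _
    · exact Finset.disjoint_left.2 fun x hx hxA => hA x hxA (hXi x hx)
  obtain ⟨S, T, hlt, hc⟩ := c.blue_cover j
  by_contra! hq
  have hY' : q ≤ Y.card := by omega
  refine c.not_cover_of_large (X := A) (Y := Y) hlt hq hY' (by omega) ?_
  intro x hx y hy hxy
  have := hA x hx
  have := hα x
  have := hYij y hy
  have := hc x y
  have := c.red_eq x y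
  grind

theorem exists_off_cell_notMem (c : CoveredColoring α β I J N p q) {i : I} {j₁ j₂ : J}
    (hj : j₁ ≠ j₂) {S X : Finset α} {T : Finset β} (hlt : S.card + T.card < p)
    (hc : ∀ x y, c.red x y → c.rL x = i → x ∈ S ∨ y ∈ T) (hX : N ≤ 2 * X.card)
    (hXij : ∀ x ∈ X, c.rL x = i ∧ c.bL x = j₂) {u : α} {w : β} (hu : u ∈ X) (huS : u ∉ S)
    (hw : c.rR w = i ∧ c.bR w = j₁ ∧ w ∉ T)
    (hoff : ∀ B : Finset β, (∀ y ∈ B, c.rR y ≠ i) → B.card < q) :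
    ∃ y, c.rR y = i ∧ c.bR y ≠ j₁ ∧ y ∉ T := by
  classical
  by_contra! hn
  have hpq := c.add_eq
  let Y : Finset β := Finset.univ.filter fun y => c.rR y = i
  let B : Finset β := Finset.univ.filter fun y => ¬ c.rR y = i
  have hYB : Y.card + B.card = N := by
    rw [← c.card_right, ← Finset.card_univ]
    exact Finset.card_filter_add_card_filter_not _
  have hB := hoff B (by simp [B])
  have h1 := c.left_few u (Y \ T) (by
    intro y hy
    simp only [Y, Finset.mem_sdiff, Finset.mem_filter, Finset.mem_univ, true_and] at hy
    have := hn y hy.1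
    have := hXij u hu
    have := hc u y
    have := c.blue_eq u y
    grind)
  have h2 := c.right_few w (X \ S) (by
    intro x hx
    rw [Finset.mem_sdiff] at hx
    have := hXij x hx.1
    have := hc x w
    have := c.blue_eq x w
    grind)
  have h3 := Finset.card_le_card_sdiff_add_card (s := X) (t := S)
  have h4 := Finset.card_le_card_sdiff_add_card (s := Y) (t := T)
  omega

/-- There are no cells in the same red component but in distinct blue components, each containing
half of one side. -/
theorem not_half_cells (c : CoveredColoring α β I J N p q) {i : I} {j₁ j₂ : J}
    (hj : j₁ ≠ j₂) {X : Finset α} {Y : Finset β} (hX : N ≤ 2 * X.card) (hY : N ≤ 2 * Y.card)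
    (hXij : ∀ x ∈ X, c.rL x = i ∧ c.bL x = j₂) (hYij : ∀ y ∈ Y, c.rR y = i ∧ c.bR y = j₁)
    (hα : ∀ x, c.rL x = i ∨ c.bL x = j₁) (hβ : ∀ y, c.rR y = i ∨ c.bR y = j₂) : False := by
  classical
  have hpq := c.add_eq
  obtain ⟨S, T, hlt, hc⟩ := c.red_cover i
  obtain ⟨S₁, T₁, hlt₁, hc₁⟩ := c.blue_cover j₁
  obtain ⟨S₂, T₂, hlt₂, hc₂⟩ := c.blue_cover j₂
  have hXS := Finset.card_le_card (c.subset_of_cover (X := X) (S := S ∪ S₂) (T := T ∪ T₂)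
    (by have := Finset.card_union_le S S₂; have := Finset.card_union_le T T₂; omega) hX (by
      intro x hx y hxy
      have := hXij x hx
      have := hc x y
      have := hc₂ x y
      simp only [Finset.mem_union]
      tauto))
  have hYT := Finset.card_le_card (c.swap.subset_of_cover (X := Y) (S := T ∪ T₁) (T := S ∪ S₁)
    (by have := Finset.card_union_le S S₁; have := Finset.card_union_le T T₁; omega) hY (by
      intro y hy x hxy
      change c.red x y ∨ c.blue x y at hxy
      have := hYij y hy
      have := hc x y
      have := hc₁ x y
      have := c.red_eq x y
      have := c.blue_eq x y
      simp only [Finset.mem_union]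
      grind))
  have h1 := Finset.card_union_le S S₂
  have h2 := Finset.card_union_le T T₁
  obtain ⟨u, hu, huS⟩ : ∃ u ∈ X, u ∉ S := by
    by_contra! hn
    have := Finset.card_le_card hn
    omega
  obtain ⟨w, hw, hwT⟩ : ∃ w ∈ Y, w ∉ T := by
    by_contra! hn
    have := Finset.card_le_card hn
    omega
  have hc' : ∀ y x, c.red x y → c.rR y = i → y ∈ T ∨ x ∈ S := fun y x hr hy =>
    (hc x y hr ((c.red_eq x y hr).trans hy)).symm
  obtain ⟨y, hy⟩ := c.exists_off_cell_notMem hj hlt hc hX hXij hu huS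
    ⟨(hYij w hw).1, (hYij w hw).2, hwT⟩
    (fun B hB => c.swap.card_off_row_lt hβ hY hX (fun y hy => (hYij y hy).1) hXij hB)
  obtain ⟨x, hx⟩ := c.swap.exists_off_cell_notMem hj.symm (by omega) hc' hY hYij hw hwT
    ⟨(hXij u hu).1, (hXij u hu).2, huS⟩
    (fun A hA => c.card_off_row_lt hα hX hY (fun x hx => (hXij x hx).1) hYij hA)
  have h3 := c.half_lt_red_cover hc ⟨(hXij u hu).1, (hXij u hu).2, huS⟩ hx
  have h4 := c.swap.half_lt_red_cover hc' ⟨(hYij w hw).1, (hYij w hw).2, hwT⟩ hy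
  omega

theorem not_small_right_cell (c : CoveredColoring α β I J N p q) (hq : 0 < q) {i : I} {j₁ j₂ : J}
    (hj : j₁ ≠ j₂) {X : Finset α} {Y : Finset β} (hY : N < 4 * Y.card) (hY' : 2 * Y.card < N)
    (hXij : ∀ x, x ∈ X ↔ c.rL x = i ∧ c.bL x = j₂) (hYij : ∀ y, y ∈ Y ↔ c.rR y = i ∧ c.bR y = j₁)
    (hα : ∀ x, c.rL x = i ∨ c.bL x = j₁) (hβ : ∀ y, c.rR y = i ∨ c.bR y = j₂) : False := by
  classical
  obtain ⟨x₀, hx₀⟩ : ∃ x, c.rL x ≠ i := by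
    by_contra! hn
    exact c.not_red_connected _ (fun x _ _ => hn x) hq
  have hx₀' := (hα x₀).resolve_left hx₀
  let Z : Finset β := Finset.univ.filter fun y => c.rR y = c.rL x₀ ∧ c.bR y = j₂
  have hZ : N < 4 * Z.card := by
    have h1 := c.left_few x₀ (Y ∪ Z)ᶜ (by
      intro y hy
      simp only [Z, Finset.mem_compl, Finset.mem_union, hYij, Finset.mem_filter, Finset.mem_univ,
        true_and] at hy
      have := hβ y
      have := c.red_eq x₀ y
      have := c.blue_eq x₀ y
      grind)
    rw [Finset.card_compl, c.card_right] at h1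
    have h2 := Finset.card_union_le Y Z
    omega
  have hα' := c.eq_or_eq_of_large (i := c.rL x₀) (j := j₂) hZ.le (by simp [Z])
  let W : Finset α := Finset.univ.filter fun x => c.rL x = c.rL x₀ ∧ c.bL x = j₁
  by_cases hW : N ≤ 4 * W.card
  · have hβ' := c.swap.eq_or_eq_of_large (i := c.rL x₀) (j := j₁) hW (by simp [W, swap])
    change ∀ y, c.rR y = c.rL x₀ ∨ c.bR y = j₁ at hβ'
    refine c.not_four_cells hx₀.symm hj (fun x => ?_) (fun y => ?_)
    · have := hα x
      have := hα' x
      grind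
    · have := hβ y
      have := hβ' y
      grind
  · have hXW : N ≤ X.card + W.card := by
      have hcov : (Finset.univ : Finset α) ⊆ X ∪ W := by
        intro x _
        simp only [W, Finset.mem_union, hXij, Finset.mem_filter, Finset.mem_univ, true_and]
        have := hα x
        have := hα' x
        grind
      have h1 := Finset.card_le_card hcov
      rw [Finset.card_univ, c.card_left] at h1
      exact h1.trans (Finset.card_union_le X W)
    let Y₁ : Finset β := Finset.univ.filter fun y => c.rR y = i ∧ c.bR y ≠ j₂
    let Y₂ : Finset β := Finset.univ.filter fun y => c.rR y ≠ i ∧ c.bR y = j₂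
    let Y₃ : Finset β := Finset.univ.filter fun y => c.rR y = i ∧ c.bR y = j₂
    have hY₁ : Y.card ≤ Y₁.card := Finset.card_le_card (by
      intro y hy
      rw [hYij] at hy
      simp only [Y₁, Finset.mem_filter, Finset.mem_univ, true_and]
      grind)
    have hY₂ : Z.card ≤ Y₂.card := Finset.card_le_card (by
      intro y hy
      simp only [Z, Y₂, Finset.mem_filter, Finset.mem_univ, true_and] at hy ⊢
      grind)
    have hY₃ := c.left_few x₀ Y₃ (by
      intro y hy
      simp only [Y₃, Finset.mem_filter, Finset.mem_univ, true_and] at hy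
      have := c.red_eq x₀ y
      have := c.blue_eq x₀ y
      grind)
    refine c.not_dominating_cell (X := X) (Y₁ := Y₁) (Y₂ := Y₂) (Y₃ := Y₃) (by omega)
      (fun x hx => (hXij x).1 hx) (by omega) (by omega) hY₃ (by simp [Y₁]) (by simp [Y₂]) ?_
    intro y
    simp only [Y₁, Y₂, Y₃, Finset.mem_filter, Finset.mem_univ, true_and]
    have := hβ y
    tauto

/-- There are no large cells, one on each side, in the same red component but in distinct blue
components. -/
theorem not_collinear_cells (c : CoveredColoring α β I J N p q) (hq : 0 < q) {i : I} {j₁ j₂ : J}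
    (hj : j₁ ≠ j₂) {X : Finset α} {Y : Finset β} (hX : N < 4 * X.card) (hY : N < 4 * Y.card)
    (hXij : ∀ x, x ∈ X ↔ c.rL x = i ∧ c.bL x = j₂)
    (hYij : ∀ y, y ∈ Y ↔ c.rR y = i ∧ c.bR y = j₁) : False := by
  have hα := c.eq_or_eq_of_large hY.le fun y hy => (hYij y).1 hy
  have hβ := c.swap.eq_or_eq_of_large hX.le fun x hx => (hXij x).1 hx
  by_cases h1 : N ≤ 2 * Y.card
  · by_cases h2 : N ≤ 2 * X.card
    · exact c.not_half_cells hj h2 h1 (fun x hx => (hXij x).1 hx) (fun y hy => (hYij y).1 hy) hα hβ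
    · exact c.swap.not_small_right_cell hq hj.symm hX (by omega) hYij hXij hβ hα
  · exact c.not_small_right_cell hq hj hY (by omega) hXij hYij hα hβ

/-- No covered coloring exists. -/
theorem impossible (c : CoveredColoring α β I J N p q) (hp : 0 < p) (hq : 0 < q) : False := by
  obtain ⟨x, x', hr, hb⟩ := c.exists_separated hp hq
  obtain ⟨i, j, Y, hY, hYij⟩ := c.exists_large_cell hr hb
  obtain ⟨y, y', hr', hb'⟩ := c.swap.exists_separated hp hq
  obtain ⟨i', j', X, hX, hXij⟩ := c.swap.exists_large_cell hr' hb'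
  change ∀ x, x ∈ X ↔ c.rL x = i' ∧ c.bL x = j' at hXij
  have hα := c.eq_or_eq_of_large hY.le fun y hy => (hYij y).1 hy
  have hβ := c.swap.eq_or_eq_of_large hX.le fun x hx => (hXij x).1 hx
  obtain ⟨z, hz⟩ := Finset.card_pos.1 (show 0 < X.card by omega)
  have hz' := hα z
  rw [((hXij z).1 hz).1, ((hXij z).1 hz).2] at hz'
  by_cases hi : i' = i
  · subst hi
    by_cases hj : j' = j
    · subst hj
      exact c.not_same_cross hp hq hα hβ
    · exact c.not_collinear_cells hq (Ne.symm hj) hX hY hXij hYij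
  · obtain rfl := hz'.resolve_left hi
    exact c.recolor.not_collinear_cells hp (Ne.symm hi) hX hY
      (fun x => (hXij x).trans and_comm) (fun y => (hYij y).trans and_comm)

end CoveredColoring

theorem stmt_0 {V : Type*} [Fintype V] [DecidableEq V] (m n : ℕ) (hn : 1 ≤ n) (hmn : n < m)
    (G : SimpleGraph V) (V1 V2 : Finset V)
    (hdisj : Disjoint V1 V2) (hcover : V1 ∪ V2 = Finset.univ)
    (hV1 : V1.card = m + n - 1) (hV2 : V2.card = m + n - 1)
    (hbip : ∀ x y, G.Adj x y → (x ∈ V1 ∧ y ∈ V2) ∨ (x ∈ V2 ∧ y ∈ V1))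
    (hδ : ∀ v, 3 * (m + n - 1) < 4 * (G.neighborSet v).ncard)
    (R B : SimpleGraph V) (hcolor : R ⊔ B = G) (hcdisj : Disjoint R B) :
    ConnMatching R m ∨ ConnMatching B n := by
  by_contra! h
  have hfew : ∀ (A A' : Finset V), Disjoint A A' → A'.card = m + n - 1 →
      (∀ x y, G.Adj x y → (x ∈ A ∧ y ∈ A') ∨ (x ∈ A' ∧ y ∈ A)) →
      ∀ (x : A) (D : Finset A'), (∀ y ∈ D, ¬ G.Adj x.1 y.1) → 4 * D.card < m + n - 1 := by
    intro A A' hd hA' hb x D hD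
    have h1 : G.neighborSet x.1 ⊆ (A' \ D.map (Function.Embedding.subtype _) : Finset V) := by
      intro y hy
      have hxy : G.Adj x.1 y := hy
      have hyA : y ∈ A' := by
        rcases hb _ _ hxy with h | h
        · exact h.2
        · exact absurd h.1 (Finset.disjoint_left.1 hd x.2)
      simp only [Finset.coe_sdiff, Set.mem_sdiff, Finset.mem_coe, Finset.mem_map, not_exists]
      refine ⟨hyA, fun z hz => hD z hz.1 ?_⟩
      have := hz.2
      simp only [Function.Embedding.subtype_apply] at this
      rwa [this]
    have h2 := Set.ncard_le_ncard h1 (Set.toFinite _)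
    rw [Set.ncard_coe_finset, Finset.card_sdiff_of_subset, Finset.card_map, hA'] at h2
    · have h3 := hδ x.1
      have h4 := Finset.card_le_univ D
      rw [Fintype.card_coe, hA'] at h4
      omega
    · intro y hy
      obtain ⟨z, _, rfl⟩ := Finset.mem_map.1 hy
      exact z.2
  have hadj : ∀ x y, ¬ R.Adj x y ∧ ¬ B.Adj x y → ¬ G.Adj x y := by
    intro x y hxy
    rw [← hcolor, SimpleGraph.sup_adj]
    tauto
  let c : CoveredColoring V1 V2 R.ConnectedComponent B.ConnectedComponent (m + n - 1) m n :=
    { red := fun x y => R.Adj x.1 y.1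
      blue := fun x y => B.Adj x.1 y.1
      rL := fun x => R.connectedComponentMk x.1
      rR := fun y => R.connectedComponentMk y.1
      bL := fun x => B.connectedComponentMk x.1
      bR := fun y => B.connectedComponentMk y.1
      card_left := by rw [Fintype.card_coe, hV1]
      card_right := by rw [Fintype.card_coe, hV2]
      add_eq := by omega
      left_few := fun x D hD => hfew V1 V2 hdisj hV2 hbip x D fun y hy => hadj _ _ (hD y hy)
      right_few := fun y D hD => hfew V2 V1 hdisj.symm hV1 (fun x y hxy => (hbip x y hxy).symm) y D
        fun x hx hyx => hadj _ _ (hD x hx) hyx.symm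
      red_eq := fun x y hxy => ConnectedComponent.connectedComponentMk_eq_of_adj hxy
      blue_eq := fun x y hxy => ConnectedComponent.connectedComponentMk_eq_of_adj hxy
      red_cover := exists_cover_of_not_connMatching hdisj h.1
      blue_cover := exists_cover_of_not_connMatching hdisj h.2 }
  exact c.impossible (by omega) (by omega)
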